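/- arXiv:2301.07852 — 2 statements merged into one kernel-verified Lean document; each statement's English description precedes it below -/
import Mathlib

section
/- Let D ⊂ ℝ² be a bounded measurable set, let F₀ : ℝ² → ℝ be a bounded measurable function vanishing outside D, and let a < b be real numbers. Define F : ℝ³ → ℝ by F(x₁,x₂,x₃) = F₀(x₁,x₂) if a ≤ x₃ ≤ b and F(x₁,x₂,x₃) = 0 otherwise. If ∫_{ℝ³} F(x) h(x) dx = 0 for every harmonic function h : ℝ³ → ℂ, then F₀ = 0 almost everywhere on ℝ², and hence F = 0 almost everywhere on ℝ³. -/
noncomputable section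
open MeasureTheory

/-- ℝ³ with the Euclidean norm. -/
abbrev R3 := EuclideanSpace ℝ (Fin 3)

/-- The Laplacian `Δf = ∑ᵢ ∂²f/∂xᵢ²` on ℝ³. -/
def lap {E : Type*} [NormedAddCommGroup E] [NormedSpace ℝ E] (f : R3 → E) (x : R3) : E :=
  ∑ i : Fin 3, iteratedFDeriv ℝ 2 f x ![EuclideanSpace.single i 1, EuclideanSpace.single i 1]

/-- A complex-valued function on ℝ³ is harmonic if it is C² and its Laplacian vanishes. -/
def HarmonicC (h : R3 → ℂ) : Prop := ContDiff ℝ 2 h ∧ ∀ x, lap h x = 0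

lemma harmonic_cexp (L : R3 →L[ℝ] ℂ)
    (hL : ∑ i : Fin 3, L (EuclideanSpace.single i 1) * L (EuclideanSpace.single i 1) = 0) :
    HarmonicC (fun x => Complex.exp (L x)) := by
  refine ⟨L.contDiff.cexp, fun x => ?_⟩
  have h1 : fderiv ℝ (fun x => Complex.exp (L x)) = fun x => Complex.exp (L x) • L := by
    ext1 x
    exact (L.hasFDerivAt.cexp).fderiv
  have h2 : fderiv ℝ (fun x => Complex.exp (L x) • L) x
      = (Complex.exp (L x) • L).smulRight L := by
    exact ((L.hasFDerivAt (x := x)).cexp.smul_const L).fderiv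
  simp only [lap, iteratedFDeriv_two_apply, h1, h2]
  have : ∀ i : Fin 3, ((Complex.exp (L x) • L).smulRight L)
      (![EuclideanSpace.single i (1:ℝ), EuclideanSpace.single i 1] 0)
      (![EuclideanSpace.single i (1:ℝ), EuclideanSpace.single i 1] 1)
      = Complex.exp (L x) * (L (EuclideanSpace.single i 1) * L (EuclideanSpace.single i 1)) := by
    intro i
    simp [mul_assoc]
  rw [Finset.sum_congr rfl (fun i _ => this i), ← Finset.mul_sum, hL, mul_zero]

lemma exists_split : ∃ e : R3 ≃ᵐ ℝ × (ℝ × ℝ), MeasurePreserving e volume volume ∧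
    ∀ x, e x = (x 2, (x 0, x 1)) := by
  refine ⟨((MeasurableEquiv.toLp 2 (Fin 3 → ℝ)).symm.trans
    (MeasurableEquiv.piFinSuccAbove (fun _ => ℝ) 2)).trans
    ((MeasurableEquiv.refl ℝ).prodCongr MeasurableEquiv.finTwoArrow), ?_, ?_⟩
  · refine MeasurePreserving.comp (g := ((MeasurableEquiv.refl ℝ).prodCongr MeasurableEquiv.finTwoArrow)) (μb := volume) ?_
      (MeasurePreserving.comp (μb := volume) (volume_preserving_piFinSuccAbove (fun _ : Fin 3 => ℝ) 2)
        (EuclideanSpace.volume_preserving_symm_measurableEquiv_toLp (Fin 3)))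
    exact (MeasurePreserving.id volume).prod (volume_preserving_finTwoArrow ℝ)
  · intro x
    rfl

lemma fourier_zero_aux (F₀ : ℝ × ℝ → ℝ) (hi : Integrable F₀) (hm : Measurable F₀)
    (h : ∀ L : StrongDual ℝ (ℝ × ℝ), ∫ v, (F₀ v : ℂ) * Complex.exp (L v * Complex.I) = 0) :
    ∀ᵐ y, F₀ y = 0 := by
  have key : ∀ f : ℝ × ℝ → ℝ, Integrable f → ∫⁻ x, ((f x).toNNReal : ENNReal) ≠ ⊤ := by
    intro f hf
    refine ne_top_of_le_ne_top (hasFiniteIntegral_iff_enorm.1 hf.2).ne (lintegral_mono fun x => by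
      rw [← ENNReal.ofReal, ← ofReal_norm]
      exact ENNReal.ofReal_le_ofReal (le_abs_self _))
  have hp := key F₀ hi
  have hn := key (fun x => - F₀ x) hi.neg
  have mp : Measurable fun x => (F₀ x).toNNReal := hm.real_toNNReal
  have mn : Measurable fun x => (- F₀ x).toNNReal := hm.neg.real_toNNReal
  have i1 : IsFiniteMeasure (volume.withDensity fun x => ((F₀ x).toNNReal : ENNReal)) :=
    isFiniteMeasure_withDensity hp
  have i2 : IsFiniteMeasure (volume.withDensity fun x => ((- F₀ x).toNNReal : ENNReal)) :=
    isFiniteMeasure_withDensity hn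
  have hEq : (volume.withDensity fun x => ((F₀ x).toNNReal : ENNReal))
      = volume.withDensity fun x => ((- F₀ x).toNNReal : ENNReal) := by
    apply Measure.ext_of_charFunDual
    ext L
    rw [charFunDual_apply, charFunDual_apply, integral_withDensity_eq_integral_smul mp,
      integral_withDensity_eq_integral_smul mn, ← sub_eq_zero]
    have hexp : ∀ f : ℝ × ℝ → ℝ, Integrable f →
        Integrable fun v => (f v).toNNReal • Complex.exp (L v * Complex.I) := by
      intro f hf
      have h0 : Integrable fun v => (f v).toNNReal • (1:ℂ) := by
        have := hf.pos_part.ofReal (𝕜 := ℂ)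
        refine this.congr (Filter.Eventually.of_forall fun v => ?_)
        simp [NNReal.smul_def]
      refine h0.mono ?_ (Filter.Eventually.of_forall fun v => ?_)
      · have : AEStronglyMeasurable (fun v => Complex.exp (L v * Complex.I)) (volume : Measure (ℝ × ℝ)) := by
          apply Continuous.aestronglyMeasurable
          fun_prop
        exact (hf.1.aemeasurable.real_toNNReal.aestronglyMeasurable).smul this
      · simp [NNReal.smul_def, Complex.norm_exp_ofReal_mul_I]
    rw [← integral_sub (hexp F₀ hi) (hexp (fun x => - F₀ x) hi.neg), ← h L]
    congr 1
    ext v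
    simp only [NNReal.smul_def, Real.coe_toNNReal', Complex.real_smul, ← sub_mul]
    congr 1
    rw [← Complex.ofReal_sub]
    congr 1
    rcases le_total (F₀ v) 0 with h | h
    · rw [max_eq_right h, max_eq_left (by linarith)]; ring
    · rw [max_eq_left h, max_eq_right (by linarith)]; ring
  have := (withDensity_eq_iff mp.coe_nnreal_ennreal.aemeasurable
    mn.coe_nnreal_ennreal.aemeasurable hp).1 hEq
  filter_upwards [this] with y hy
  have hy' : (F₀ y).toNNReal = (- F₀ y).toNNReal := by exact_mod_cast hy
  have := congrArg (fun z : NNReal => (z : ℝ)) hy'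
  simp only [Real.coe_toNNReal'] at this
  rcases le_total (F₀ y) 0 with h | h
  · rw [max_eq_right h, max_eq_left (by linarith)] at this; linarith
  · rw [max_eq_left h, max_eq_right (by linarith)] at this; linarith

theorem stmt_10 (D : Set (ℝ × ℝ)) (hDm : MeasurableSet D) (hDb : Bornology.IsBounded D)
    (F₀ : ℝ × ℝ → ℝ) (hF₀m : Measurable F₀) (hF₀b : ∃ C, ∀ y, |F₀ y| ≤ C)
    (hF₀supp : ∀ y ∉ D, F₀ y = 0)
    (a b : ℝ) (hab : a < b)
    (F : R3 → ℝ)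
    (hF : ∀ x : R3, F x = if a ≤ x 2 ∧ x 2 ≤ b then F₀ (x 0, x 1) else 0)
    (horth : ∀ h : R3 → ℂ, HarmonicC h → ∫ x : R3, (F x : ℂ) * h x = 0) :
    (∀ᵐ y : ℝ × ℝ ∂volume, F₀ y = 0) ∧ (∀ᵐ x : R3 ∂volume, F x = 0) := by
  obtain ⟨C, hC⟩ := hF₀b
  obtain ⟨e, he, hev⟩ := exists_split
  have hi : Integrable F₀ := by
    have hon : IntegrableOn F₀ D := by
      refine Measure.integrableOn_of_bounded (M := C) hDb.measure_lt_top.ne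
        hF₀m.aestronglyMeasurable (Filter.Eventually.of_forall fun y => ?_)
      simpa using hC y
    exact hon.integrable_of_forall_notMem_eq_zero hF₀supp
  have hmain : ∀ᵐ y : ℝ × ℝ ∂volume, F₀ y = 0 := by
    refine fourier_zero_aux F₀ hi hF₀m fun L => ?_
    set p := L (1, 0) with hp
    set q := L (0, 1) with hq
    have hLv : ∀ v : ℝ × ℝ, L v = p * v.1 + q * v.2 := by
      intro v
      have : v = v.1 • ((1:ℝ), (0:ℝ)) + v.2 • ((0:ℝ), (1:ℝ)) := by ext <;> simp
      conv_lhs => rw [this]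
      rw [map_add, map_smul, map_smul]
      simp [hp, hq, mul_comm]
    set s := Real.sqrt (p ^ 2 + q ^ 2) with hs
    have hs2 : s * s = p ^ 2 + q ^ 2 := Real.mul_self_sqrt (by positivity)
    let M : R3 →L[ℝ] ℂ :=
      (p • (EuclideanSpace.proj 0 : R3 →L[ℝ] ℝ)
        + q • (EuclideanSpace.proj 1 : R3 →L[ℝ] ℝ)).smulRight Complex.I
      + (s • (EuclideanSpace.proj 2 : R3 →L[ℝ] ℝ)).smulRight (1 : ℂ)
    have hM : ∀ x : R3, M x = ((p * x 0 + q * x 1 : ℝ) : ℂ) * Complex.I + ((s * x 2 : ℝ) : ℂ) := by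
      intro x
      simp [M]
    have hs2' : (s : ℂ) * s = p ^ 2 + q ^ 2 := by exact_mod_cast hs2
    have hh := horth _ (harmonic_cexp M (by
      simp only [Fin.sum_univ_three, hM]
      simp
      linear_combination hs2' + ((p:ℂ) ^ 2 + q ^ 2) * Complex.I_mul_I))
    let G : ℝ → ℝ := (Set.Icc a b).indicator fun t => Real.exp (s * t)
    have hpt : ∀ x : R3, (F x : ℂ) * Complex.exp (M x)
        = (fun z : ℝ × (ℝ × ℝ) => (G z.1 : ℂ) * ((F₀ z.2 : ℂ) * Complex.exp (L z.2 * Complex.I)))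
          (e x) := by
      intro x
      rw [hF, hM, Complex.exp_add, hev]
      simp only [hLv, G, Set.indicator_apply, Set.mem_Icc]
      split_ifs
      · push_cast; ring
      · simp
    rw [integral_congr_ae (Filter.Eventually.of_forall hpt),
      he.integral_comp e.measurableEmbedding (fun z : ℝ × (ℝ × ℝ) =>
        (G z.1 : ℂ) * ((F₀ z.2 : ℂ) * Complex.exp (L z.2 * Complex.I))), Measure.volume_eq_prod,
      integral_prod_mul (fun t => (G t : ℂ))
        (fun v => (F₀ v : ℂ) * Complex.exp (L v * Complex.I))] at hh
    refine (mul_eq_zero.1 hh).resolve_left ?_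
    rw [integral_complex_ofReal, Complex.ofReal_eq_zero,
      integral_indicator measurableSet_Icc, integral_Icc_eq_integral_Ioc,
      ← intervalIntegral.integral_of_le hab.le]
    refine (intervalIntegral.intervalIntegral_pos_of_pos ?_ (fun t => Real.exp_pos _) hab).ne'
    exact Continuous.intervalIntegrable (by fun_prop) _ _
  refine ⟨hmain, ?_⟩
  have hq : Measure.QuasiMeasurePreserving (fun x : R3 => (e x).2) volume volume :=
    Measure.quasiMeasurePreserving_snd.comp he.quasiMeasurePreserving
  filter_upwards [hq.ae hmain] with x hx
  rw [hev] at hx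
  rw [hF, hx, ite_self]
end
end

section
/- Let 0 < r < R, and let F : ℝ³ → ℝ be a bounded measurable function vanishing outside the closed ball of radius r centered at the origin. If the Newtonian potential of F vanishes on the sphere of radius R, i.e. ∫_{ℝ³} F(y)/(4π|x−y|) dy = 0 for every x ∈ ℝ³ with |x| = R, then all harmonic moments of F vanish: ∫_{ℝ³} F(y) h(y) dy = 0 for every harmonic function h : ℝ³ → ℝ. -/
noncomputable section
open MeasureTheory

/-- A real-valued function on ℝ³ is harmonic if it is C² and its Laplacian vanishes. -/
def Harmonic (h : R3 → ℝ) : Prop := ContDiff ℝ 2 h ∧ ∀ x, lap h x = 0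

open Filter Topology

/-- basis vector -/
abbrev ee (i : Fin 3) : R3 := EuclideanSpace.single i 1

/-- regularised kernel -/
def GG (s : ℝ) (z : R3) : ℝ := (‖z‖ ^ 2 + s) ^ (-(1 / 2) : ℝ)
/-- first derivative -/
def GG1 (s : ℝ) (i : Fin 3) (z : R3) : ℝ := -(z i) * (‖z‖ ^ 2 + s) ^ (-(3 / 2) : ℝ)
/-- second derivative -/
def GG2 (s : ℝ) (i : Fin 3) (z : R3) : ℝ :=
  3 * (z i) ^ 2 * (‖z‖ ^ 2 + s) ^ (-(5 / 2) : ℝ) - (‖z‖ ^ 2 + s) ^ (-(3 / 2) : ℝ)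

lemma GG_meas (s : ℝ) : Measurable (GG s) := by unfold GG; fun_prop
lemma GG1_meas (s : ℝ) (i : Fin 3) : Measurable (GG1 s i) := by unfold GG1; fun_prop
lemma GG2_meas (s : ℝ) (i : Fin 3) : Measurable (GG2 s i) := by unfold GG2; fun_prop

lemma GG_nonneg (s : ℝ) (hs : 0 ≤ s) (z : R3) : 0 ≤ GG s z := by unfold GG; positivity

lemma GG_zero (z : R3) : GG 0 z = ‖z‖⁻¹ := by
  unfold GG
  rw [add_zero, ← Real.rpow_natCast, ← Real.rpow_mul (norm_nonneg _), ← Real.rpow_neg_one]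
  norm_num

lemma normsq_line (z : R3) (i : Fin 3) (t : ℝ) :
    ‖z + t • ee i‖ ^ 2 = ‖z‖ ^ 2 + 2 * t * z i + t ^ 2 := by
  rw [norm_add_sq_real]
  simp [inner_smul_right, norm_smul, EuclideanSpace.inner_single_right]
  ring

lemma hasDeriv_q (s : ℝ) (i : Fin 3) (z : R3) (t : ℝ) :
    HasDerivAt (fun t : ℝ => ‖z + t • ee i‖ ^ 2 + s) (2 * (z + t • ee i) i) t := by
  simp only [normsq_line]
  have h : HasDerivAt (fun t : ℝ => ‖z‖ ^ 2 + 2 * t * z i + t ^ 2 + s)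
      (2 * 1 * z i + 2 * t) t := by
    have h1 : HasDerivAt (fun t : ℝ => 2 * t * z i) (2 * 1 * z i) t :=
      ((hasDerivAt_id t).const_mul 2).mul_const _
    have h2 : HasDerivAt (fun t : ℝ => t ^ 2) (2 * t) t := by
      simpa using hasDerivAt_pow 2 t
    exact ((h1.const_add _).add h2).add_const _
  convert h using 1
  simp; ring

lemma hasDeriv_coord (i : Fin 3) (z : R3) (t : ℝ) :
    HasDerivAt (fun t : ℝ => (z + t • ee i) i) 1 t := by
  have h : HasDerivAt (fun t : ℝ => z i + t) 1 t := (hasDerivAt_id t).const_add _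
  simpa using h

lemma GG_deriv (s : ℝ) (i : Fin 3) (z : R3) (t : ℝ) (h : 0 < ‖z + t • ee i‖ ^ 2 + s) :
    HasDerivAt (fun t : ℝ => GG s (z + t • ee i)) (GG1 s i (z + t • ee i)) t := by
  have := (hasDeriv_q s i z t).rpow_const (p := (-(1/2) : ℝ)) (Or.inl h.ne')
  unfold GG GG1
  convert this using 1
  norm_num
  ring

lemma GG1_deriv (s : ℝ) (i : Fin 3) (z : R3) (t : ℝ) (h : 0 < ‖z + t • ee i‖ ^ 2 + s) :
    HasDerivAt (fun t : ℝ => GG1 s i (z + t • ee i)) (GG2 s i (z + t • ee i)) t := by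
  have := (hasDeriv_coord i z t).neg.mul
    ((hasDeriv_q s i z t).rpow_const (p := (-(3/2) : ℝ)) (Or.inl h.ne'))
  refine HasDerivAt.congr_deriv this ?_
  unfold GG2
  simp only [Pi.neg_apply]
  rw [show (-(3/2) - 1 : ℝ) = -(5/2) by norm_num]
  ring

lemma sum_GG2 (s : ℝ) (z : R3) (h : 0 < ‖z‖ ^ 2 + s) :
    ∑ i, GG2 s i z = -(3 * s * (‖z‖ ^ 2 + s) ^ (-(5 / 2) : ℝ)) := by
  have hn : ‖z‖ ^ 2 = z 0 ^ 2 + z 1 ^ 2 + z 2 ^ 2 := by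
    rw [EuclideanSpace.norm_sq_eq]; simp [Fin.sum_univ_three]
  have h3 : (‖z‖ ^ 2 + s) ^ (-(3 / 2) : ℝ) = (‖z‖ ^ 2 + s) * (‖z‖ ^ 2 + s) ^ (-(5 / 2) : ℝ) := by
    rw [← Real.rpow_one_add' h.le (by norm_num)]; norm_num
  simp only [GG2, Fin.sum_univ_three, h3]
  generalize (‖z‖ ^ 2 + s) ^ (-(5 / 2) : ℝ) = w
  rw [hn]; ring

lemma coord_le (z : R3) (i : Fin 3) : |z i| ≤ ‖z‖ := by
  simpa using PiLp.norm_apply_le z i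

lemma GG_bound (d : ℝ) (hd : 0 < d) (s : ℝ) (hs : 0 ≤ s) (z : R3) (hz : d ≤ ‖z‖) :
    |GG s z| ≤ d⁻¹ := by
  rw [abs_of_nonneg (GG_nonneg s hs z)]
  have : d⁻¹ = (d ^ 2) ^ (-(1/2) : ℝ) := by
    rw [← Real.rpow_natCast, ← Real.rpow_mul hd.le, ← Real.rpow_neg_one]; norm_num
  rw [this]
  unfold GG
  apply Real.rpow_le_rpow_of_nonpos (by positivity) _ (by norm_num)
  nlinarith

lemma rb (d : ℝ) (hd : 0 < d) (p : ℝ) (hp : 0 ≤ p) (z : R3) (hz : d ≤ ‖z‖) :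
    (‖z‖ ^ 2 + 0) ^ (-p) ≤ (d ^ 2) ^ (-p) := by
  apply Real.rpow_le_rpow_of_nonpos (by positivity) _ (by linarith)
  nlinarith

lemma GG1_bound (d : ℝ) (hd : 0 < d) : ∃ B, ∀ (i : Fin 3) (z : R3), d ≤ ‖z‖ → |GG1 0 i z| ≤ B := by
  refine ⟨(d ^ 2) ^ (-1 : ℝ), fun i z hz => le_trans ?_ (rb d hd 1 (by norm_num) z hz)⟩
  have hz0 : 0 < ‖z‖ := hd.trans_le hz
  unfold GG1
  rw [abs_mul, abs_neg, abs_of_nonneg (by positivity : 0 ≤ (‖z‖ ^ 2 + 0) ^ (-(3 / 2) : ℝ))]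
  have : (‖z‖ ^ 2 + 0) ^ (-1 : ℝ) = ‖z‖ * (‖z‖ ^ 2 + 0) ^ (-(3 / 2) : ℝ) := by
    rw [add_zero, ← Real.rpow_natCast, ← Real.rpow_mul hz0.le, ← Real.rpow_mul hz0.le,
      ← Real.rpow_one_add' hz0.le (by norm_num)]
    norm_num
  rw [this]
  gcongr
  exact coord_le z i

lemma GG2_bound (d : ℝ) (hd : 0 < d) : ∃ B, ∀ (i : Fin 3) (z : R3), d ≤ ‖z‖ → |GG2 0 i z| ≤ B := by
  refine ⟨4 * (d ^ 2) ^ (-(3/2) : ℝ), fun i z hz => ?_⟩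
  have h0 := rb d hd (3/2) (by norm_num) z hz
  have hz0 : 0 < ‖z‖ := hd.trans_le hz
  have h3 : (‖z‖ ^ 2 + 0) ^ (-(3 / 2) : ℝ) = (‖z‖ ^ 2) * (‖z‖ ^ 2 + 0) ^ (-(5 / 2) : ℝ) := by
    have : 0 < ‖z‖ ^ 2 + 0 := by positivity
    nth_rewrite 2 [← add_zero (‖z‖ ^ 2)]
    rw [← Real.rpow_one_add' this.le (by norm_num)]; norm_num
  have hw : 0 ≤ (‖z‖ ^ 2 + 0) ^ (-(5 / 2) : ℝ) := by positivity
  have hc : (z i) ^ 2 ≤ ‖z‖ ^ 2 := by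
    rw [← sq_abs]; gcongr; exact coord_le z i
  unfold GG2
  rw [h3] at h0 ⊢
  generalize (‖z‖ ^ 2 + 0) ^ (-(5 / 2) : ℝ) = w at *
  have h5 := mul_le_mul_of_nonneg_right hc hw
  have h6 : 0 ≤ (z i) ^ 2 * w := by positivity
  rw [abs_le]; constructor <;> nlinarith

lemma second_test (f f' : ℝ → ℝ) (c : ℝ) (h1 : ∀ᶠ t in 𝓝 0, HasDerivAt f (f' t) t)
    (h2 : HasDerivAt f' c 0) (hm : IsLocalMax f 0) : c ≤ 0 := by
  by_contra hc
  push Not at hc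
  have he : deriv f =ᶠ[𝓝 0] f' := h1.mono fun t ht => ht.deriv
  have hdd : deriv (deriv f) 0 = c := by rw [he.deriv_eq]; exact h2.deriv
  have hmin := isLocalMin_of_deriv_deriv_pos (by rw [hdd]; exact hc) hm.deriv_eq_zero
    h1.self_of_nhds.continuousAt
  have hcst : f =ᶠ[𝓝 0] fun _ => f 0 := by
    filter_upwards [hm, hmin] with t a b using le_antisymm a b
  have := hcst.deriv.deriv_eq
  rw [hdd] at this
  simp at this
  linarith

lemma F_int {r : ℝ} {F : R3 → ℝ}
    (hFm : Measurable F) (hFb : ∃ C, ∀ x, |F x| ≤ C)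
    (hFsupp : ∀ x ∉ Metric.closedBall (0 : R3) r, F x = 0) : Integrable F := by
  obtain ⟨C, hC⟩ := hFb
  have : IntegrableOn F (Metric.closedBall (0 : R3) r) :=
    Measure.integrableOn_of_bounded (M := C) (isCompact_closedBall _ _).measure_lt_top.ne
      hFm.aestronglyMeasurable (ae_of_all _ hC)
  rwa [integrableOn_iff_integrable_of_support_subset] at this
  intro x hx
  by_contra h
  exact hx (hFsupp x h)

lemma pot_deriv {r : ℝ} {F : R3 → ℝ} (hF : Integrable F) (hFm : Measurable F)
    (hFsupp : ∀ x ∉ Metric.closedBall (0 : R3) r, F x = 0) (g g' : R3 → ℝ) (hg : Measurable g)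
    (hg' : Measurable g') (v : R3) (d B B' : ℝ)
    (hB : ∀ z, d ≤ ‖z‖ → |g z| ≤ B) (hB' : ∀ z, d ≤ ‖z‖ → |g' z| ≤ B')
    (hd : ∀ z (t : ℝ), d ≤ ‖z + t • v‖ → HasDerivAt (fun t : ℝ => g (z + t • v)) (g' (z + t • v)) t)
    (x : R3) (t : ℝ) (hx : d + r < ‖x + t • v‖) :
    Integrable (fun y => F y * g' (x + t • v - y)) ∧
    HasDerivAt (fun t : ℝ => ∫ y, F y * g (x + t • v - y))
      (∫ y, F y * g' (x + t • v - y)) t := by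
  have hlow : ∀ (τ : ℝ) (y : R3), d + r < ‖x + τ • v‖ → ‖y‖ ≤ r → d ≤ ‖x + τ • v - y‖ := by
    intro τ y h1 h2
    have := norm_sub_norm_le (x + τ • v) y
    linarith
  have hbd : ∀ (k : R3 → ℝ) (B : ℝ), (∀ z, d ≤ ‖z‖ → |k z| ≤ B) → ∀ (τ : ℝ) (y : R3),
      d + r < ‖x + τ • v‖ → ‖F y * k (x + τ • v - y)‖ ≤ |F y| * B := by
    intro k B hk τ y h1
    by_cases hy : y ∈ Metric.closedBall (0 : R3) r
    · rw [norm_mul]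
      simp only [Real.norm_eq_abs]
      gcongr
      exact hk _ (hlow τ y h1 (by simpa using hy))
    · simp [hFsupp y hy]
  have hmeas : ∀ (k : R3 → ℝ), Measurable k → ∀ τ : ℝ,
      AEStronglyMeasurable (fun y => F y * k (x + τ • v - y)) volume := by
    intro k hk τ
    apply Measurable.aestronglyMeasurable
    exact hFm.mul (hk.comp (by fun_prop))
  refine hasDerivAt_integral_of_dominated_loc_of_deriv_le
    (F := fun (t : ℝ) y => F y * g (x + t • v - y))
    (F' := fun (t : ℝ) y => F y * g' (x + t • v - y))
    (s := {τ : ℝ | d + r < ‖x + τ • v‖}) (bound := fun y => |F y| * B')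
    ?_ ?_ ?_ ?_ ?_ ?_ ?_
  · exact (isOpen_lt continuous_const (by fun_prop)).mem_nhds hx
  · exact Eventually.of_forall fun τ => hmeas g hg τ
  · exact (hF.abs.mul_const B).mono' (hmeas g hg t) (ae_of_all _ fun y => hbd g B hB t y hx)
  · exact hmeas g' hg' t
  · exact ae_of_all _ fun y τ hτ => hbd g' B' hB' τ y hτ
  · exact hF.abs.mul_const _
  · refine ae_of_all _ fun y τ hτ => ?_
    by_cases hy : y ∈ Metric.closedBall (0 : R3) r
    · have := hd (x - y) τ (by
        have := hlow τ y hτ (by simpa using hy)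
        convert this using 2; abel)
      have e : ∀ t : ℝ, x + t • v - y = x - y + t • v := fun t => by abel
      simp only [e]
      exact this.const_mul _
    · simp only [hFsupp y hy, zero_mul]
      exact hasDerivAt_const _ _

lemma pot_bound {r : ℝ} {F : R3 → ℝ} 
    (hFsupp : ∀ x ∉ Metric.closedBall (0 : R3) r, F x = 0) (d s : ℝ) (hd : 0 < d) (hs : 0 ≤ s)
    (x y : R3) (hx : d + r ≤ ‖x‖) : ‖F y * GG s (x - y)‖ ≤ |F y| * d⁻¹ := by
  by_cases hy : y ∈ Metric.closedBall (0 : R3) r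
  · rw [norm_mul]
    simp only [Real.norm_eq_abs]
    gcongr
    apply GG_bound d hd s hs
    have := norm_sub_norm_le x y
    have : ‖y‖ ≤ r := by simpa using hy
    linarith
  · simp [hFsupp y hy]

lemma pot_cont {r : ℝ} {F : R3 → ℝ} (hF : Integrable F) (hFm : Measurable F)
    (hFsupp : ∀ x ∉ Metric.closedBall (0 : R3) r, F x = 0) (x : R3) (hx : r < ‖x‖) :
    ContinuousAt (fun x => ∫ y, F y * GG 0 (x - y)) x := by
  set d := (‖x‖ - r) / 2 with hd
  have hd0 : 0 < d := by rw [hd]; linarith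
  apply continuousAt_of_dominated (bound := fun y => |F y| * d⁻¹)
  · refine Eventually.of_forall fun x => ?_
    exact (hFm.mul ((GG_meas 0).comp (by fun_prop))).aestronglyMeasurable
  · have : ∀ᶠ x' in 𝓝 x, d + r < ‖x'‖ :=
      (isOpen_lt continuous_const continuous_norm).mem_nhds (by
        change d + r < ‖x‖
        rw [hd]; linarith)
    filter_upwards [this] with x' hx'
    exact ae_of_all _ fun y => pot_bound hFsupp d 0 hd0 le_rfl x' y hx'.le
  · exact hF.abs.mul_const _
  · refine ae_of_all _ fun y => ?_
    by_cases hy : y ∈ Metric.closedBall (0 : R3) r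
    · have : x - y ≠ 0 := by
        intro h
        rw [sub_eq_zero] at h
        have : ‖y‖ ≤ r := by simpa using hy
        rw [← h] at this
        linarith
      simp only [GG_zero]
      refine continuousAt_const.mul (ContinuousAt.inv₀ (by fun_prop) (by simpa using this))
    · simp only [hFsupp y hy, zero_mul]
      exact continuousAt_const

lemma pot_nonpos {r R : ℝ} (hr : 0 < r) (hrR : r < R) {F : R3 → ℝ}
    (hF : Integrable F) (hFm : Measurable F)
    (hFsupp : ∀ x ∉ Metric.closedBall (0 : R3) r, F x = 0)
    (hpot : ∀ x : R3, ‖x‖ = R → ∫ y : R3, F y * GG 0 (x - y) = 0) (x₀ : R3) (hx₀ : R ≤ ‖x₀‖) :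
    ∫ y : R3, F y * GG 0 (x₀ - y) ≤ 0 := by
  by_contra hcon
  push Not at hcon
  set u : R3 → ℝ := fun x => ∫ y : R3, F y * GG 0 (x - y) with hu
  obtain ⟨δ, hδ, hδ2⟩ : ∃ δ > 0, 0 < u x₀ - δ * GG 1 x₀ := by
    refine ⟨u x₀ / (2 * (GG 1 x₀ + 1)), ?_, ?_⟩
    · have := GG_nonneg 1 (by norm_num) x₀
      exact div_pos hcon (by positivity)
    · have := GG_nonneg 1 (by norm_num) x₀
      have h2 : u x₀ / (2 * (GG 1 x₀ + 1)) * GG 1 x₀ < u x₀ := by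
        rw [div_mul_eq_mul_div, div_lt_iff₀ (by positivity)]
        have : 0 < u x₀ := hcon
        nlinarith
      linarith
  set v : R3 → ℝ := fun x => u x - δ * GG 1 x with hv
  set I : ℝ := ∫ y, |F y| with hI
  have hI0 : 0 ≤ I := integral_nonneg fun y => abs_nonneg _
  have hGp : ∀ x : R3, 0 < GG 1 x := fun x => by unfold GG; positivity
  have hdec : ∀ x d, 0 < d → d + r ≤ ‖x‖ → u x ≤ I * d⁻¹ := by
    intro x d hd hx
    have := norm_integral_le_of_norm_le (hF.abs.mul_const d⁻¹)
      (ae_of_all _ fun y => pot_bound hFsupp d 0 hd le_rfl x y hx)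
    rw [integral_mul_const] at this
    exact (le_abs_self _).trans this
  have hv0 : 0 < v x₀ := hδ2
  set M := ‖x₀‖ + r + I / v x₀ + 1 with hM
  have hIv : 0 ≤ I / v x₀ := div_nonneg hI0 hv0.le
  have hMx : ‖x₀‖ < M := by rw [hM]; linarith
  have hfar : ∀ x : R3, ‖x‖ = M → v x < v x₀ := by
    intro x hx
    have h1 := hdec x (M - r) (by rw [hM]; linarith [norm_nonneg x₀]) (by rw [hx]; linarith)
    have h2 : I * (M - r)⁻¹ < v x₀ := by
      have hpos : 0 < M - r := by rw [hM]; linarith [norm_nonneg x₀]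
      rw [← div_eq_mul_inv, div_lt_iff₀ hpos]
      have : I = v x₀ * (I / v x₀) := by field_simp
      nlinarith [norm_nonneg x₀]
    have := hGp x
    simp only [hv] at h2 ⊢
    nlinarith
  have hK : IsCompact (Metric.closedBall (0 : R3) M ∩ {x | R ≤ ‖x‖}) :=
    (isCompact_closedBall _ _).inter_right (isClosed_le continuous_const continuous_norm)
  have hGc : Continuous (GG 1) := by
    unfold GG
    refine Continuous.rpow_const (by fun_prop) fun x => Or.inl (by positivity)
  have hvc : ContinuousOn v (Metric.closedBall (0 : R3) M ∩ {x | R ≤ ‖x‖}) := by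
    intro x hx
    have hx2 : R ≤ ‖x‖ := hx.2
    exact ((pot_cont hF hFm hFsupp x (by linarith)).sub
      (by fun_prop)).continuousWithinAt
  obtain ⟨x₁, hx₁, hmax⟩ := hK.exists_isMaxOn
    ⟨x₀, by simpa using hMx.le, hx₀⟩ hvc
  have hge : v x₀ ≤ v x₁ := hmax ⟨by simpa using hMx.le, hx₀⟩
  have h1R : R < ‖x₁‖ := by
    refine lt_of_le_of_ne hx₁.2 fun h => ?_
    have h0 : u x₁ = 0 := hpot x₁ h.symm
    have := hGp x₁
    have h3 : v x₁ = 0 - δ * GG 1 x₁ := by rw [← h0]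
    nlinarith
  have h1M : ‖x₁‖ < M := by
    refine lt_of_le_of_ne (by simpa using hx₁.1) fun h => ?_
    linarith [hfar x₁ h]
  have hloc : IsLocalMax v x₁ := by
    have hn : ∀ᶠ x in 𝓝 x₁, R < ‖x‖ ∧ ‖x‖ < M :=
      ((isOpen_lt continuous_const continuous_norm).inter
        (isOpen_lt continuous_norm continuous_const)).mem_nhds ⟨h1R, h1M⟩
    filter_upwards [hn] with x hx
    exact hmax ⟨by simpa using hx.2.le, hx.1.le⟩
  set d := R - r with hd
  have hd0 : 0 < d := by rw [hd]; linarith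
  obtain ⟨B1, hB1⟩ := GG1_bound d hd0
  obtain ⟨B2, hB2⟩ := GG2_bound d hd0
  have hqpos : ∀ z : R3, d ≤ ‖z‖ → 0 < ‖z‖ ^ 2 + 0 := fun z hz => by
    have := hd0.trans_le hz
    positivity
  have hside : ∀ i, Integrable (fun y => F y * GG2 0 i (x₁ - y)) ∧
      (∫ y, F y * GG2 0 i (x₁ - y)) - δ * GG2 1 i x₁ ≤ 0 := by
    intro i
    have D1 := fun t ht => pot_deriv hF hFm hFsupp (GG 0) (GG1 0 i) (GG_meas _) (GG1_meas _ _) (ee i)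
      d d⁻¹ B1 (fun z hz => GG_bound d hd0 0 le_rfl z hz) (hB1 i)
      (fun z t h => GG_deriv 0 i z t (hqpos _ h)) x₁ t ht
    have D2 := pot_deriv hF hFm hFsupp (GG1 0 i) (GG2 0 i) (GG1_meas _ _) (GG2_meas _ _) (ee i)
      d B1 B2 (hB1 i) (hB2 i)
      (fun z t h => GG1_deriv 0 i z t (hqpos _ h)) x₁ 0 (by simp [hd]; exact h1R)
    refine ⟨by simpa using D2.1, ?_⟩
    apply second_test (fun t : ℝ => v (x₁ + t • ee i))
      (fun t : ℝ => (∫ y, F y * GG1 0 i (x₁ + t • ee i - y)) - δ * GG1 1 i (x₁ + t • ee i))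
    · have : ∀ᶠ t : ℝ in 𝓝 0, d + r < ‖x₁ + t • ee i‖ :=
        (isOpen_lt continuous_const (by fun_prop)).mem_nhds (by simp [hd]; exact h1R)
      filter_upwards [this] with t ht
      exact (D1 t ht).2.sub ((GG_deriv 1 i x₁ t (by positivity)).const_mul δ)
    · have := D2.2.sub ((GG1_deriv 1 i x₁ 0 (by positivity)).const_mul δ)
      simp only [zero_smul, add_zero] at this
      exact this
    · have hc : ContinuousAt (fun t : ℝ => x₁ + t • ee i) 0 := by fun_prop
      have : IsLocalMax v (x₁ + (0 : ℝ) • ee i) := by simpa using hloc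
      exact hc.eventually this
  have hsum : ∑ i, ((∫ y, F y * GG2 0 i (x₁ - y)) - δ * GG2 1 i x₁) ≤ 0 :=
    Finset.sum_nonpos fun i _ => (hside i).2
  rw [Finset.sum_sub_distrib, ← Finset.mul_sum, sum_GG2 1 x₁ (by positivity),
    ← integral_finsetSum _ fun i _ => (hside i).1] at hsum
  have hz : ∫ y, ∑ i, F y * GG2 0 i (x₁ - y) = 0 := by
    apply integral_eq_zero_of_ae
    refine ae_of_all _ fun y => ?_
    change ∑ i, F y * GG2 0 i (x₁ - y) = 0
    by_cases hy : y ∈ Metric.closedBall (0 : R3) r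
    · rw [← Finset.mul_sum, sum_GG2]
      · simp
      · apply hqpos
        have := norm_sub_norm_le x₁ y
        have : ‖y‖ ≤ r := by simpa using hy
        linarith
    · simp [hFsupp y hy]
  rw [hz] at hsum
  have : 0 < (‖x₁‖ ^ 2 + 1) ^ (-(5 / 2) : ℝ) := by positivity
  nlinarith [mul_pos hδ this]

lemma pot_zero {r R : ℝ} (hr : 0 < r) (hrR : r < R) {F : R3 → ℝ}
    (hF : Integrable F) (hFm : Measurable F)
    (hFsupp : ∀ x ∉ Metric.closedBall (0 : R3) r, F x = 0)
    (hpot : ∀ x : R3, ‖x‖ = R → ∫ y : R3, F y * GG 0 (x - y) = 0) (x₀ : R3) (hx₀ : R ≤ ‖x₀‖) :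
    ∫ y : R3, F y * GG 0 (x₀ - y) = 0 := by
  apply le_antisymm (pot_nonpos hr hrR hF hFm hFsupp hpot x₀ hx₀)
  have := pot_nonpos hr hrR (F := fun y => - F y) hF.neg hFm.neg
    (fun x hx => by simp [hFsupp x hx])
    (fun x hx => by simp only [neg_mul, integral_neg, hpot x hx, neg_zero]) x₀ hx₀
  simp only [neg_mul, integral_neg] at this
  linarith

lemma hasLineDeriv_of_contDiff {f : R3 → ℝ} (hf : ContDiff ℝ 1 f) (x v : R3) :
    HasLineDerivAt ℝ f (fderiv ℝ f x v) x v :=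
  ((hf.differentiable one_ne_zero) x).hasFDerivAt.hasLineDerivAt v

/-- first partial derivative -/
def D1 (f : R3 → ℝ) (i : Fin 3) (x : R3) : ℝ := fderiv ℝ f x (ee i)

lemma D1_contDiff {f : R3 → ℝ} (hf : ContDiff ℝ 2 f) (i : Fin 3) : ContDiff ℝ 1 (D1 f i) :=
  (hf.fderiv_right (m := 1) (by norm_num)).clm_apply contDiff_const

lemma D1_cont {f : R3 → ℝ} (hf : ContDiff ℝ 1 f) (i : Fin 3) : Continuous (D1 f i) :=
  (hf.continuous_fderiv one_ne_zero).clm_apply continuous_const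

lemma D1_supp {f : R3 → ℝ} (hf : HasCompactSupport f) (i : Fin 3) : HasCompactSupport (D1 f i) :=
  hf.fderiv_apply (𝕜 := ℝ) (ee i)

lemma lap_eq {f : R3 → ℝ} (hf : ContDiff ℝ 2 f) (x : R3) :
    lap f x = ∑ i, D1 (D1 f i) i x := by
  unfold lap
  refine Finset.sum_congr rfl fun i _ => ?_
  rw [iteratedFDeriv_two_apply]
  have hd : DifferentiableAt ℝ (fderiv ℝ f) x :=
    (hf.fderiv_right (m := 1) (by norm_num)).differentiable one_ne_zero x
  unfold D1
  rw [fderiv_clm_apply hd (differentiableAt_const _)]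
  simp

lemma lap_cont {f : R3 → ℝ} (hf : ContDiff ℝ 2 f) : Continuous (lap f) := by
  rw [funext (lap_eq hf)]
  exact continuous_finsetSum _ fun i _ => D1_cont (D1_contDiff hf i) i

lemma lap_supp {f : R3 → ℝ} (hf : ContDiff ℝ 2 f) (hs : HasCompactSupport f) :
    HasCompactSupport (lap f) := by
  rw [funext (lap_eq hf)]
  simp only [Fin.sum_univ_three]
  exact ((D1_supp (D1_supp hs 0) 0).add (D1_supp (D1_supp hs 1) 1)).add (D1_supp (D1_supp hs 2) 2)

lemma q_cont (s : ℝ) (hs : 0 < s) (p : ℝ) : Continuous fun z : R3 => (‖z‖ ^ 2 + s) ^ p :=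
  Continuous.rpow_const (by fun_prop) fun x => Or.inl (by positivity)

lemma GG_cont (s : ℝ) (hs : 0 < s) : Continuous (GG s) := q_cont s hs _
lemma GG1_cont (s : ℝ) (hs : 0 < s) (i : Fin 3) : Continuous (GG1 s i) := by
  have := q_cont s hs (-(3/2))
  unfold GG1; fun_prop
lemma GG2_cont (s : ℝ) (hs : 0 < s) (i : Fin 3) : Continuous (GG2 s i) := by
  have := q_cont s hs (-(3/2))
  have := q_cont s hs (-(5/2))
  unfold GG2; fun_prop

/-- approximate identity -/
def kk (s : ℝ) (z : R3) : ℝ := 3 * s * (‖z‖ ^ 2 + s) ^ (-(5 / 2) : ℝ)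

lemma int_prod {f g : R3 → ℝ} (hf : Continuous f) (hg : Continuous g) (hs : HasCompactSupport g) :
    Integrable (fun x => f x * g x) :=
  (hf.mul hg).integrable_of_hasCompactSupport hs.mul_left

lemma ibp_i {f : R3 → ℝ} (hf : ContDiff ℝ 2 f) (hsu : HasCompactSupport f) (s : ℝ) (hs : 0 < s)
    (y : R3) (i : Fin 3) :
    ∫ x, GG s (x - y) * D1 (D1 f i) i x = ∫ x, GG2 s i (x - y) * f x := by
  have c0 : Continuous fun x => GG s (x - y) := (GG_cont s hs).comp (by fun_prop)
  have c1 : Continuous fun x => GG1 s i (x - y) := (GG1_cont s hs i).comp (by fun_prop)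
  have c2 : Continuous fun x => GG2 s i (x - y) := (GG2_cont s hs i).comp (by fun_prop)
  have f0 := hf.continuous
  have f1 := D1_cont (hf.of_le (by norm_num)) i
  have f2 := D1_cont (D1_contDiff hf i) i
  have s1 := D1_supp hsu i
  have s2 := D1_supp s1 i
  have e : ∀ (x : R3) (t : ℝ), x + t • ee i - y = x - y + t • ee i := fun x t => by abel
  have A := integral_bilinear_hasLineDerivAt_right_eq_neg_left_of_integrable (μ := volume)
    (f := fun x => GG s (x - y)) (f' := fun x => GG1 s i (x - y)) (g := D1 f i)
    (g' := D1 (D1 f i) i) (v := ee i) (B := ContinuousLinearMap.mul ℝ ℝ)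
    (int_prod c1 f1 s1) (int_prod c0 f2 s2) (int_prod c0 f1 s1)
    (fun x _ => by
      unfold HasLineDerivAt
      simp only [e]
      have := GG_deriv s i (x - y) 0 (by positivity)
      simp only [zero_smul, add_zero] at this
      exact this)
    (fun x _ => hasLineDeriv_of_contDiff (D1_contDiff hf i) x _)
  have B := integral_bilinear_hasLineDerivAt_right_eq_neg_left_of_integrable (μ := volume)
    (f := fun x => GG1 s i (x - y)) (f' := fun x => GG2 s i (x - y)) (g := f)
    (g' := D1 f i) (v := ee i) (B := ContinuousLinearMap.mul ℝ ℝ)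
    (int_prod c2 f0 hsu) (int_prod c1 f1 s1) (int_prod c1 f0 hsu)
    (fun x _ => by
      unfold HasLineDerivAt
      simp only [e]
      have := GG1_deriv s i (x - y) 0 (by positivity)
      simp only [zero_smul, add_zero] at this
      exact this)
    (fun x _ => hasLineDeriv_of_contDiff (hf.of_le (by norm_num)) x _)
  simp only [ContinuousLinearMap.mul_apply'] at A B
  rw [A, B, neg_neg]

lemma ibp {f : R3 → ℝ} (hf : ContDiff ℝ 2 f) (hsu : HasCompactSupport f) (s : ℝ) (hs : 0 < s)
    (y : R3) : ∫ x, GG s (x - y) * lap f x = - ∫ x, kk s (x - y) * f x := by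
  have c0 : Continuous fun x => GG s (x - y) := (GG_cont s hs).comp (by fun_prop)
  have c2 : ∀ i, Continuous fun x => GG2 s i (x - y) :=
    fun i => (GG2_cont s hs i).comp (by fun_prop)
  simp only [lap_eq hf, Finset.mul_sum]
  rw [integral_finsetSum _ fun i _ => int_prod c0 (D1_cont (D1_contDiff hf i) i)
    (D1_supp (D1_supp hsu i) i)]
  simp only [ibp_i hf hsu s hs]
  rw [← integral_finsetSum _ fun i _ => int_prod (c2 i) hf.continuous hsu, ← integral_neg]
  congr 1
  ext x
  rw [← Finset.sum_mul, sum_GG2 s _ (by positivity)]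
  unfold kk
  ring

lemma kk_int : Integrable (kk 1) := by
  have := integrable_rpow_neg_one_add_norm_sq (E := R3) (μ := volume) (r := 5) (by simp; norm_num)
  have := this.const_mul 3
  convert this using 2 with z
  unfold kk
  rw [add_comm]
  norm_num

lemma kk_pos (z : R3) : 0 < kk 1 z := by unfold kk; positivity

lemma kk_int_pos : 0 < ∫ z, kk 1 z := by
  rw [integral_pos_iff_support_of_nonneg (fun z => (kk_pos z).le) kk_int]
  have : Function.support (kk 1) = Set.univ := by
    ext z; simp [(kk_pos z).ne']
  rw [this]
  exact Measure.measure_univ_pos.2 (NeZero.ne _)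

lemma kk_scale (f : R3 → ℝ) (y : R3) (ε : ℝ) (hε : 0 < ε) :
    ∫ x, kk (ε ^ 2) (x - y) * f x = ∫ z, kk 1 z * f (ε • z + y) := by
  have h1 := integral_sub_right_eq_self (μ := volume)
    (fun x => kk (ε ^ 2) x * f (x + y)) y
  simp only [sub_add_cancel] at h1
  rw [h1]
  have h2 := Measure.integral_comp_smul_of_nonneg volume
    (fun x => kk (ε ^ 2) x * f (x + y)) ε (hR := hε.le)
  have h3 : Module.finrank ℝ R3 = 3 := by simp
  rw [h3, smul_eq_mul, eq_inv_mul_iff_mul_eq₀ (by positivity), ← integral_const_mul] at h2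
  rw [← h2]
  congr 1
  ext z
  rw [← mul_assoc]
  congr 1
  unfold kk
  rw [norm_smul, Real.norm_eq_abs, abs_of_pos hε,
    show (ε * ‖z‖) ^ 2 + ε ^ 2 = ε ^ 2 * (‖z‖ ^ 2 + 1) by ring,
    Real.mul_rpow (by positivity) (by positivity)]
  have : (ε ^ 2) ^ (-(5 / 2) : ℝ) = (ε ^ 5)⁻¹ := by
    rw [← Real.rpow_natCast, ← Real.rpow_mul hε.le, ← Real.rpow_natCast, ← Real.rpow_neg hε.le]
    norm_num
  rw [this]
  field_simp

lemma GG_tendsto (z : R3) (hz : z ≠ 0) :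
    Tendsto (fun ε : ℝ => GG (ε ^ 2) z) (𝓝[>] 0) (𝓝 (GG 0 z)) := by
  have hz0 : 0 < ‖z‖ := norm_pos_iff.2 hz
  have : ContinuousAt (fun ε : ℝ => GG (ε ^ 2) z) 0 := by
    unfold GG
    exact ContinuousAt.rpow_const (by fun_prop) (Or.inl (by positivity))
  have := this.tendsto
  simp only [ne_eq, OfNat.ofNat_ne_zero, not_false_eq_true, zero_pow] at this
  exact this.mono_left nhdsWithin_le_nhds

lemma repr_formula {f : R3 → ℝ} (hf : ContDiff ℝ 2 f) (hsu : HasCompactSupport f) (y : R3) (d : ℝ)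
    (hd : 0 < d) (hl : ∀ x, ‖x - y‖ < d → lap f x = 0) :
    ∫ x, GG 0 (x - y) * lap f x = - ((∫ z, kk 1 z) * f y) := by
  have T1 : Tendsto (fun ε : ℝ => ∫ x, GG (ε ^ 2) (x - y) * lap f x) (𝓝[>] 0)
      (𝓝 (∫ x, GG 0 (x - y) * lap f x)) := by
    apply tendsto_integral_filter_of_dominated_convergence (fun x => d⁻¹ * |lap f x|)
    · refine Eventually.of_forall fun ε => ?_
      exact (((GG_meas _).comp (by fun_prop)).mul (lap_cont hf).measurable).aestronglyMeasurable
    · refine Eventually.of_forall fun ε => ae_of_all _ fun x => ?_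
      by_cases hx : ‖x - y‖ < d
      · simp [hl x hx]
      · rw [norm_mul]
        simp only [Real.norm_eq_abs]
        gcongr
        exact GG_bound d hd _ (by positivity) _ (not_lt.1 hx)
    · exact ((lap_cont hf).integrable_of_hasCompactSupport (lap_supp hf hsu)).abs.const_mul _
    · refine ae_of_all _ fun x => ?_
      by_cases hx : ‖x - y‖ < d
      · simp [hl x hx]
      · refine (GG_tendsto _ ?_).mul_const _
        intro h
        rw [h] at hx
        simp at hx
        linarith
  obtain ⟨C, hC⟩ := hsu.exists_bound_of_continuous hf.continuous
  have T2 : Tendsto (fun ε : ℝ => ∫ z, kk 1 z * f (ε • z + y)) (𝓝[>] 0)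
      (𝓝 (∫ z, kk 1 z * f y)) := by
    apply tendsto_integral_filter_of_dominated_convergence (fun z => kk 1 z * C)
    · refine Eventually.of_forall fun ε => ?_
      exact kk_int.aestronglyMeasurable.mul
        (hf.continuous.comp (by fun_prop)).aestronglyMeasurable
    · refine Eventually.of_forall fun ε => ae_of_all _ fun z => ?_
      rw [norm_mul, Real.norm_of_nonneg (kk_pos z).le]
      exact mul_le_mul_of_nonneg_left (hC _) (kk_pos z).le
    · exact kk_int.mul_const _
    · refine ae_of_all _ fun z => Tendsto.const_mul _ ?_
      have hc : Continuous fun ε : ℝ => f (ε • z + y) := hf.continuous.comp (by fun_prop)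
      have := hc.tendsto 0
      simp only [zero_smul, zero_add] at this
      exact this.mono_left nhdsWithin_le_nhds
  rw [integral_mul_const] at T2
  refine tendsto_nhds_unique T1 (T2.neg.congr' ?_)
  filter_upwards [self_mem_nhdsWithin] with ε hε
  have hε : 0 < ε := hε
  rw [ibp hf hsu _ (by positivity) y, kk_scale f y ε hε]

/-- If `F` is bounded measurable, supported in the closed ball of radius
`r < R`, and its Newtonian potential `∫ F(y)/(4π|x−y|) dy` vanishes on the sphere
`|x| = R`, then all harmonic moments of `F` vanish. -/
theorem stmt_12 (r R : ℝ) (hr : 0 < r) (hrR : r < R) (F : R3 → ℝ)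
    (hFm : Measurable F) (hFb : ∃ C, ∀ x, |F x| ≤ C)
    (hFsupp : ∀ x ∉ Metric.closedBall (0 : R3) r, F x = 0)
    (hpot : ∀ x : R3, ‖x‖ = R → ∫ y : R3, F y / (4 * Real.pi * ‖x - y‖) = 0) :
    ∀ h : R3 → ℝ, Harmonic h → ∫ y : R3, F y * h y = 0 := by
  intro h hh
  have hF := F_int hFm hFb hFsupp
  have hpot' : ∀ x : R3, ‖x‖ = R → ∫ y : R3, F y * GG 0 (x - y) = 0 := by
    intro x hx
    have h1 := hpot x hx
    have e : ∀ y, F y / (4 * Real.pi * ‖x - y‖) = (4 * Real.pi)⁻¹ * (F y * GG 0 (x - y)) := by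
      intro y
      rw [GG_zero, div_eq_mul_inv, mul_inv]; ring
    simp only [e] at h1
    rw [integral_const_mul] at h1
    exact (mul_eq_zero.1 h1).resolve_left (by positivity)
  have hu := pot_zero hr hrR hF hFm hFsupp hpot'
  let χ : ContDiffBump (0 : R3) := ⟨R, R + 1, by linarith, by linarith⟩
  set f : R3 → ℝ := fun x => χ x * h x with hfdef
  have hf : ContDiff ℝ 2 f := χ.contDiff.mul hh.1
  have hsu : HasCompactSupport f := χ.hasCompactSupport.mul_right
  have hfh : ∀ x : R3, ‖x‖ < R → f =ᶠ[𝓝 x] h := by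
    intro x hx
    have : (χ : R3 → ℝ) =ᶠ[𝓝 x] 1 := χ.eventuallyEq_one_of_mem_ball (by simpa using hx)
    filter_upwards [this] with z hz
    simp [hfdef, hz]
  have hl : ∀ x : R3, ‖x‖ < R → lap f x = 0 := by
    intro x hx
    rw [← hh.2 x]
    unfold lap
    rw [((hfh x hx).iteratedFDeriv ℝ 2).self_of_nhds]
  have hrep : ∀ y : R3, ‖y‖ ≤ r →
      ∫ x, GG 0 (x - y) * lap f x = - ((∫ z, kk 1 z) * h y) := by
    intro y hy
    rw [repr_formula hf hsu y (R - r) (by linarith), (hfh y (by linarith)).self_of_nhds]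
    intro x hx
    apply hl
    have := norm_sub_norm_le x y
    linarith
  have hli : Integrable (lap f) := (lap_cont hf).integrable_of_hasCompactSupport (lap_supp hf hsu)
  have hswap : ∫ y, ∫ x, F y * GG 0 (x - y) * lap f x = ∫ x, ∫ y, F y * GG 0 (x - y) * lap f x := by
    apply integral_integral_swap
    have hb : Integrable (fun p : R3 × R3 => (R - r)⁻¹ * (|F p.1| * |lap f p.2|))
        (volume.prod volume) := (hF.abs.mul_prod hli.abs).const_mul _
    refine hb.mono' ?_ (ae_of_all _ ?_)
    · apply Measurable.aestronglyMeasurable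
      have m1 : Measurable fun p : R3 × R3 => GG 0 (p.2 - p.1) := (GG_meas 0).comp (by fun_prop)
      have m2 : Measurable fun p : R3 × R3 => F p.1 := hFm.comp measurable_fst
      have m3 : Measurable fun p : R3 × R3 => lap f p.2 := (lap_cont hf).measurable.comp measurable_snd
      exact (m2.mul m1).mul m3
    · rintro ⟨y, x⟩
      simp only [Function.uncurry]
      by_cases hx : ‖x‖ < R
      · simp [hl x hx]
      · have := pot_bound hFsupp (R - r) 0 (by linarith) le_rfl x y (by linarith)
        rw [norm_mul, Real.norm_eq_abs (lap f x)]
        calc _ ≤ |F y| * (R - r)⁻¹ * |lap f x| := by gcongr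
          _ = _ := by ring
  have hR : ∫ x, ∫ y, F y * GG 0 (x - y) * lap f x = 0 := by
    apply integral_eq_zero_of_ae
    refine ae_of_all _ fun x => ?_
    change ∫ y, F y * GG 0 (x - y) * lap f x = 0
    by_cases hx : ‖x‖ < R
    · simp [hl x hx]
    · rw [integral_mul_const, hu x (not_lt.1 hx), zero_mul]
  have hL : ∫ y, ∫ x, F y * GG 0 (x - y) * lap f x = - (∫ z, kk 1 z) * ∫ y, F y * h y := by
    rw [← integral_const_mul]
    congr 1
    ext y
    by_cases hy : y ∈ Metric.closedBall (0 : R3) r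
    · simp only [mul_assoc]
      rw [integral_const_mul, hrep y (by simpa using hy)]
      ring
    · simp [hFsupp y hy]
  rw [hswap, hR] at hL
  have := kk_int_pos
  exact (mul_eq_zero.1 hL.symm).resolve_left (by linarith)
end
end
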